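/- Assume c > 0 and that A_{i,j} ≥ κ hᵢ for all i, j, for some κ > 0. Then there exist constants h₀ > 0 and c₀ > 0, depending only on p, β⁻, β⁺, γ, c, κ and b−a, such that whenever h ≤ h₀ the discrete inf-sup condition holds: for every nonzero v in the immersed trial space U_T there exists a test coefficient vector w with ‖w‖_{T'} > 0 and a(v, w) ≥ c₀ ‖v‖_G ‖w‖_{T'}. -/

import Mathlib

open Set

/-- The piecewise-constant diffusion coefficient with interface point `α`. -/
noncomputable def betaPW (βm βp α : ℝ) : ℝ → ℝ := fun t => if t < α then βm else βp

/-- Membership in the immersed trial space `U_T`: continuous on `[a,b]`, zero boundary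
values, a polynomial of degree ≤ p on each non-interface element `[x_{i-1}, x_i]` (i ≠ k),
and on the interface element `[x_{k-1}, x_k]` a continuous piecewise polynomial of degree ≤ p
satisfying the derivative jump conditions at the interface `α`. -/
def MemUT (p N k : ℕ) (a b α βm βp : ℝ) (x : ℕ → ℝ) (v : ℝ → ℝ) : Prop :=
  ContinuousOn v (Set.Icc a b) ∧ v a = 0 ∧ v b = 0 ∧
  (∀ i, 1 ≤ i → i ≤ N → i ≠ k → ∃ q : Polynomial ℝ, q.natDegree ≤ p ∧
    ∀ y ∈ Set.Icc (x (i - 1)) (x i), v y = q.eval y) ∧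
  ∃ qm qp : Polynomial ℝ, qm.natDegree ≤ p ∧ qp.natDegree ≤ p ∧
    (∀ y ∈ Set.Icc (x (k - 1)) α, v y = qm.eval y) ∧
    (∀ y ∈ Set.Icc α (x k), v y = qp.eval y) ∧
    ∀ j, 1 ≤ j → j ≤ p →
      βm * ((⇑Polynomial.derivative)^[j] qm).eval α
        = βp * ((⇑Polynomial.derivative)^[j] qp).eval α

/-- The previous value `v_{i,j-1}` of a test coefficient vector, with the conventions
`v_{1,0} = 0` and `v_{i,0} = v_{i-1,p}`. -/
noncomputable def vprev (p : ℕ) (w : ℕ → ℕ → ℝ) (i j : ℕ) : ℝ :=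
  if j = 1 then (if i = 1 then 0 else w (i - 1) p) else w i (j - 1)

/-- The jump `[v_{i,j}] = v_{i,j} − v_{i,j−1}` of a test coefficient vector. -/
noncomputable def jmp (p : ℕ) (w : ℕ → ℕ → ℝ) (i j : ℕ) : ℝ := w i j - vprev p w i j

/-- The squared norm `‖v‖²_{T'} = |v|²_{1,T'} + ‖v‖²_{0,T'}` on test coefficient vectors. -/
noncomputable def normTpSq (N p : ℕ) (x : ℕ → ℝ) (w : ℕ → ℕ → ℝ) : ℝ :=
  (∑ i ∈ Finset.Icc 1 N, ∑ j ∈ Finset.Icc 1 p, (x i - x (i - 1))⁻¹ * (jmp p w i j) ^ 2)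
    + ∑ i ∈ Finset.Icc 1 N, ∑ j ∈ Finset.Icc 1 (if i < N then p else p - 1),
        (x i - x (i - 1)) * (w i j) ^ 2

/-- The norm `‖v‖_{T'}` on test coefficient vectors. -/
noncomputable def normTp (N p : ℕ) (x : ℕ → ℝ) (w : ℕ → ℕ → ℝ) : ℝ :=
  Real.sqrt (normTpSq N p x w)

/-- The IFVM bilinear form
`a(u,v) = Σᵢ Σ_{j=1}^{p} [v_{i,j}] β(g_{i,j}) u′(g_{i,j})
        + Σᵢ Σ_{j=1}^{pᵢ} v_{i,j} ∫_{g_{i,j}}^{g_{i,j+1}} (γ u′ + c u)`. -/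
noncomputable def aform (N p : ℕ) (γ c βm βp α : ℝ) (g : ℕ → ℕ → ℝ)
    (u : ℝ → ℝ) (w : ℕ → ℕ → ℝ) : ℝ :=
  (∑ i ∈ Finset.Icc 1 N, ∑ j ∈ Finset.Icc 1 p,
      jmp p w i j * (betaPW βm βp α (g i j) * deriv u (g i j)))
    + ∑ i ∈ Finset.Icc 1 N, ∑ j ∈ Finset.Icc 1 (if i < N then p else p - 1),
        w i j * ∫ t in (g i j)..(g i (j + 1)), (γ * deriv u t + c * u t)

/-- The squared discrete flux seminorm `|u|²_G = Σᵢ Σⱼ A_{i,j} (β(g_{i,j}) u′(g_{i,j}))²`. -/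
noncomputable def gseminormSq (N p : ℕ) (βm βp α : ℝ) (g A : ℕ → ℕ → ℝ) (u : ℝ → ℝ) : ℝ :=
  ∑ i ∈ Finset.Icc 1 N, ∑ j ∈ Finset.Icc 1 p,
    A i j * (betaPW βm βp α (g i j) * deriv u (g i j)) ^ 2

/-- The discrete energy norm `‖u‖_G`, where `‖u‖²_G = |u|²_G + ‖u‖²₁`. -/
noncomputable def gnorm (N p : ℕ) (a b βm βp α : ℝ) (g A : ℕ → ℕ → ℝ) (u : ℝ → ℝ) : ℝ :=
  Real.sqrt (gseminormSq N p βm βp α g A u + ∫ t in a..b, ((deriv u t) ^ 2 + (u t) ^ 2))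

open MeasureTheory

lemma mesh_le {N : ℕ} {x : ℕ → ℝ} (hx : ∀ i, i < N → x i < x (i + 1)) {i j : ℕ}
    (hij : i ≤ j) (hj : j ≤ N) : x i ≤ x j := by
  induction j, hij using Nat.le_induction with
  | base => exact le_rfl
  | succ n _ ih => exact (ih (by omega)).trans (hx n (by omega)).le

lemma exists_mem_element {N : ℕ} {x : ℕ → ℝ} {t : ℝ} (h0 : x 0 < t) (hN : t < x N)
    (ht : t ∉ range x) : ∃ i ∈ Finset.Icc 1 N, t ∈ Ioo (x (i - 1)) (x i) := by
  classical
  have hex : ∃ i, t < x i := ⟨N, hN⟩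
  have hpos : Nat.find hex ≠ 0 := fun h => by
    have := Nat.find_spec hex
    rw [h] at this
    linarith
  have hprev := Nat.find_min hex (Nat.sub_one_lt hpos)
  refine ⟨Nat.find hex, Finset.mem_Icc.2 ⟨Nat.one_le_iff_ne_zero.2 hpos, Nat.find_min' hex hN⟩,
    lt_of_le_of_ne (not_lt.1 hprev) fun h => ht ⟨_, h⟩, Nat.find_spec hex⟩

lemma sum_Icc_one_eq_sum_range (N : ℕ) (G : ℕ → ℝ) :
    ∑ i ∈ Finset.Icc 1 N, G i = ∑ i ∈ Finset.range N, G (i + 1) := by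
  induction N with
  | zero => simp
  | succ n ih => rw [Finset.sum_Icc_succ_top (by omega), Finset.sum_range_succ, ih]

lemma sum_Icc_one_sub (N : ℕ) (G : ℕ → ℝ) :
    ∑ i ∈ Finset.Icc 1 N, (G i - G (i - 1)) = G N - G 0 := by
  rw [sum_Icc_one_eq_sum_range]
  simpa using Finset.sum_range_sub G N

lemma min_le_betaPW (βm βp α t : ℝ) : min βm βp ≤ betaPW βm βp α t := by
  unfold betaPW
  split_ifs
  exacts [min_le_left _ _, min_le_right _ _]

lemma measurable_betaPW (βm βp α : ℝ) : Measurable (betaPW βm βp α) :=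
  Measurable.ite measurableSet_Iio measurable_const measurable_const

/-- Two polynomials whose derivatives agree at a point agree. -/
lemma Polynomial.eq_of_iterate_derivative_eval_eq {P Q : Polynomial ℝ} {α : ℝ}
    (h : ∀ j, ((⇑Polynomial.derivative)^[j] P).eval α = ((⇑Polynomial.derivative)^[j] Q).eval α) :
    P = Q := by
  apply Polynomial.taylor_injective α
  ext n
  have hn := h n
  rw [← Polynomial.factorial_smul_hasseDeriv] at hn
  change (n.factorial • Polynomial.hasseDeriv n P).eval α
    = (n.factorial • Polynomial.hasseDeriv n Q).eval α at hn
  rw [nsmul_eq_mul, nsmul_eq_mul, Polynomial.eval_mul, Polynomial.eval_mul,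
    Polynomial.eval_natCast] at hn
  rw [Polynomial.taylor_coeff, Polynomial.taylor_coeff]
  exact mul_left_cancel₀ (Nat.cast_ne_zero.2 n.factorial_ne_zero) hn

lemma hasDerivAt_of_eqOn_Icc {v : ℝ → ℝ} {r : Polynomial ℝ} {y z t : ℝ}
    (h : ∀ s ∈ Icc y z, v s = r.eval s) (ht : t ∈ Ioo y z) :
    HasDerivAt v (r.derivative.eval t) t :=
  (r.hasDerivAt t).congr_of_eventuallyEq <| by
    filter_upwards [Icc_mem_nhds ht.1 ht.2] with s hs using h s hs

/-- On every element, the flux `β v'` of a trial function is a polynomial of degree `< p`. -/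
lemma MemUT.exists_flux {p N k : ℕ} {a b α βm βp : ℝ} {x : ℕ → ℝ} {v : ℝ → ℝ}
    (hv : MemUT p N k a b α βm βp x v) (hβm : 0 < βm) (hβp : 0 < βp)
    (hk : 1 ≤ k) (hkN : k ≤ N)
    (hx : ∀ i, i < N → x i < x (i + 1)) (hα₁ : x (k - 1) < α) (hα₂ : α < x k)
    {i : ℕ} (hi : i ∈ Finset.Icc 1 N) :
    ∃ q : Polynomial ℝ, q.natDegree ≤ p - 1 ∧ ∀ t ∈ Ioo (x (i - 1)) (x i), t ≠ α →
      HasDerivAt v (q.eval t / betaPW βm βp α t) t := by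
  obtain ⟨-, -, -, hpoly, qm, qp, hqm, hqp, hvm, hvp, hjump⟩ := hv
  obtain ⟨hi1, hiN⟩ := Finset.mem_Icc.1 hi
  have hdeg : ∀ (β : ℝ) {r : Polynomial ℝ}, r.natDegree ≤ p →
      (Polynomial.C β * r.derivative).natDegree ≤ p - 1 := fun β r hr =>
    (Polynomial.natDegree_C_mul_le _ _).trans
      ((Polynomial.natDegree_derivative_le r).trans (Nat.sub_le_sub_right hr 1))
  rcases lt_trichotomy i k with hik | rfl | hik
  · obtain ⟨r, hr, hvr⟩ := hpoly i hi1 hiN hik.ne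
    refine ⟨Polynomial.C βm * r.derivative, hdeg βm hr, fun t ht _ => ?_⟩
    have hlt : t < α := ht.2.trans_le ((mesh_le hx (by omega) (by omega)).trans hα₁.le)
    convert hasDerivAt_of_eqOn_Icc hvr ht using 1
    simp [betaPW, hlt, hβm.ne']
  · have heq : Polynomial.C βm * qm.derivative = Polynomial.C βp * qp.derivative := by
      refine Polynomial.eq_of_iterate_derivative_eval_eq (α := α) fun j => ?_
      rw [Polynomial.iterate_derivative_C_mul, Polynomial.iterate_derivative_C_mul,
        ← Function.iterate_succ_apply, ← Function.iterate_succ_apply]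
      simp only [Polynomial.eval_mul, Polynomial.eval_C]
      rcases le_or_gt (j + 1) p with hj | hj
      · exact hjump (j + 1) (by omega) hj
      · rw [Polynomial.iterate_derivative_eq_zero (by omega),
          Polynomial.iterate_derivative_eq_zero (by omega)]
        simp
    refine ⟨Polynomial.C βm * qm.derivative, hdeg βm hqm, fun t ht htα => ?_⟩
    rcases lt_or_gt_of_ne htα with hlt | hgt
    · convert hasDerivAt_of_eqOn_Icc hvm ⟨ht.1, hlt⟩ using 1
      simp [betaPW, hlt, hβm.ne']
    · rw [heq]
      convert hasDerivAt_of_eqOn_Icc hvp ⟨hgt, ht.2⟩ using 1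
      simp [betaPW, hgt.not_gt, hβp.ne']
  · obtain ⟨r, hr, hvr⟩ := hpoly i hi1 hiN hik.ne'
    refine ⟨Polynomial.C βp * r.derivative, hdeg βp hr, fun t ht _ => ?_⟩
    have hgt : α < t := (hα₂.trans_le (mesh_le hx (by omega) (by omega))).trans ht.1
    convert hasDerivAt_of_eqOn_Icc hvr ht using 1
    simp [betaPW, hgt.not_gt, hβp.ne']

lemma MeasureTheory.MemLp.intervalIntegrable_of_subset {f : ℝ → ℝ} {a b y z : ℝ}
    (hf : MemLp f ⊤ (volume.restrict (Icc a b))) (hy : y ∈ Icc a b) (hz : z ∈ Icc a b) :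
    IntervalIntegrable f volume y z := by
  have h : IntegrableOn f (Icc a b) := hf.integrable le_top
  rw [intervalIntegrable_iff]
  exact h.mono_set (uIoc_subset_uIcc.trans (uIcc_subset_Icc hy hz))

lemma ContinuousOn.memLp_top_Icc {f : ℝ → ℝ} {a b : ℝ} (hf : ContinuousOn f (Icc a b)) :
    MemLp f ⊤ (volume.restrict (Icc a b)) := by
  obtain ⟨M, hM⟩ := isCompact_Icc.exists_bound_of_continuousOn hf
  exact memLp_top_of_bound (hf.aestronglyMeasurable measurableSet_Icc) M
    ((ae_restrict_iff' measurableSet_Icc).2 (Filter.Eventually.of_forall hM))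

/-- The Cauchy–Schwarz inequality against the constant function one. -/
lemma sq_integral_abs_le {f : ℝ → ℝ} {y z : ℝ} (hyz : y ≤ z)
    (hf : MemLp f ⊤ (volume.restrict (Icc y z))) :
    (∫ t in y..z, |f t|) ^ 2 ≤ (z - y) * ∫ t in y..z, f t ^ 2 := by
  rcases hyz.eq_or_lt with rfl | hlt
  · simp
  have hy : y ∈ Icc y z := left_mem_Icc.2 hyz
  have hz : z ∈ Icc y z := right_mem_Icc.2 hyz
  have h1 : IntervalIntegrable (fun t => |f t|) volume y z :=
    (hf.intervalIntegrable_of_subset hy hz).abs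
  have h2 : IntervalIntegrable (fun t => f t ^ 2) volume y z := by
    have : MemLp (fun t => f t * f t) ⊤ (volume.restrict (Icc y z)) := hf.mul hf
    simpa only [sq] using this.intervalIntegrable_of_subset hy hz
  set m := (∫ t in y..z, |f t|) / (z - y) with hm
  have hpos : 0 < z - y := sub_pos.2 hlt
  have hI : ∫ t in y..z, |f t| = m * (z - y) := by rw [hm]; field_simp
  have key : 0 ≤ ∫ t in y..z, (f t ^ 2 - 2 * m * |f t| + m ^ 2) :=
    intervalIntegral.integral_nonneg hyz fun t _ => by
      nlinarith [sq_nonneg (|f t| - m), sq_abs (f t)]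
  rw [intervalIntegral.integral_add (h2.sub (h1.const_mul _)) intervalIntegrable_const,
    intervalIntegral.integral_sub h2 (h1.const_mul _), intervalIntegral.integral_const_mul,
    intervalIntegral.integral_const, hI, smul_eq_mul] at key
  rw [hI]
  nlinarith [mul_nonneg hpos.le key]

/-- Quadrature error on one element: `∑ⱼ Aⱼ rⱼ F(gⱼ)` approximates `∫ D F` when the rule is
exact for `F = 1`. -/
lemma abs_quadrature_sub_integral_le {ι : Type*} (s : Finset ι) {A r g : ι → ℝ}
    {y z b₀ E : ℝ} {D f F : ℝ → ℝ} (hyz : y ≤ z)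
    (hD : MemLp D ⊤ (volume.restrict (Icc y z))) (hf : MemLp f ⊤ (volume.restrict (Icc y z)))
    (hF : ContinuousOn F (Icc y z)) (hFf : ∀ t ∈ Icc y z, F t - F y = ∫ u in y..t, f u)
    (hg : ∀ j ∈ s, g j ∈ Icc y z) (hA : ∀ j ∈ s, 0 ≤ A j)
    (hr : ∑ j ∈ s, A j * r j = ∫ t in y..z, D t) (hAs : ∑ j ∈ s, A j ≤ (z - y) / b₀)
    (hE : ∑ j ∈ s, A j * r j ^ 2 = E) (hDE : ∫ t in y..z, D t ^ 2 ≤ E / b₀) :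
    |∑ j ∈ s, A j * r j * F (g j) - ∫ t in y..z, D t * F t|
      ≤ (z - y) / 2 * ((∫ t in y..z, f t ^ 2) + 4 * E / b₀) := by
  have hy : y ∈ Icc y z := left_mem_Icc.2 hyz
  have hz : z ∈ Icc y z := right_mem_Icc.2 hyz
  have hE0 : 0 ≤ E := hE ▸ Finset.sum_nonneg fun j hj => mul_nonneg (hA j hj) (sq_nonneg _)
  set P := ∫ t in y..z, |f t| with hP
  have hfi := (hf.intervalIntegrable_of_subset hy hz).abs
  have hDi := hD.intervalIntegrable_of_subset hy hz
  have hbound : ∀ t ∈ Icc y z, |F t - F y| ≤ P := fun t ht => by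
    rw [hFf t ht]
    refine (intervalIntegral.abs_integral_le_integral_abs ht.1).trans ?_
    exact intervalIntegral.integral_mono_interval le_rfl ht.1 ht.2
      (Filter.Eventually.of_forall fun t => abs_nonneg _) hfi
  have hP0 : 0 ≤ P := intervalIntegral.integral_nonneg hyz fun t _ => abs_nonneg _
  have hDFm : MemLp (fun t => D t * (F t - F y)) ⊤ (volume.restrict (Icc y z)) :=
    (hF.sub continuousOn_const).memLp_top_Icc.mul hD
  have hDF : IntervalIntegrable (fun t => D t * (F t - F y)) volume y z :=
    hDFm.intervalIntegrable_of_subset hy hz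
  have hsplit : ∑ j ∈ s, A j * r j * F (g j) - ∫ t in y..z, D t * F t
      = ∑ j ∈ s, A j * r j * (F (g j) - F y) - ∫ t in y..z, D t * (F t - F y) := by
    have h1 : ∫ t in y..z, D t * F t
        = (∫ t in y..z, D t * (F t - F y)) + F y * ∫ t in y..z, D t := by
      rw [← intervalIntegral.integral_const_mul,
        ← intervalIntegral.integral_add hDF (hDi.const_mul _)]
      congr 1
      ext t
      ring
    rw [h1, ← hr, Finset.mul_sum]
    simp only [mul_sub, Finset.sum_sub_distrib]
    rw [Finset.sum_congr rfl fun j _ => mul_comm (F y) (A j * r j)]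
    ring
  set Q := ∑ j ∈ s, A j * |r j| with hQ
  set R := ∫ t in y..z, |D t| with hR
  have hsum : |∑ j ∈ s, A j * r j * (F (g j) - F y)| ≤ P * Q := by
    rw [hQ, Finset.mul_sum]
    refine (Finset.abs_sum_le_sum_abs _ _).trans (Finset.sum_le_sum fun j hj => ?_)
    rw [abs_mul, abs_mul, abs_of_nonneg (hA j hj), mul_comm P]
    exact mul_le_mul_of_nonneg_left (hbound _ (hg j hj))
      (mul_nonneg (hA j hj) (abs_nonneg _))
  have hint : |∫ t in y..z, D t * (F t - F y)| ≤ P * R := by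
    refine (intervalIntegral.abs_integral_le_integral_abs hyz).trans ?_
    rw [hR, ← intervalIntegral.integral_const_mul]
    refine intervalIntegral.integral_mono_on hyz hDF.abs (hDi.abs.const_mul _) fun t ht => ?_
    rw [abs_mul, mul_comm P]
    exact mul_le_mul_of_nonneg_left (hbound t ht) (abs_nonneg _)
  have hP2 : P ^ 2 ≤ (z - y) * ∫ t in y..z, f t ^ 2 := sq_integral_abs_le hyz hf
  have hzy : 0 ≤ z - y := sub_nonneg.2 hyz
  have hR2 : R ^ 2 ≤ (z - y) * (E / b₀) :=
    (sq_integral_abs_le hyz hD).trans (mul_le_mul_of_nonneg_left hDE hzy)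
  have hQ2 : Q ^ 2 ≤ (z - y) * (E / b₀) := by
    have h := Finset.sum_sq_le_sum_mul_sum_of_sq_le_mul s (r := fun j => A j * |r j|) (f := A)
      (g := fun j => A j * r j ^ 2) hA (fun j hj => mul_nonneg (hA j hj) (sq_nonneg _))
      (fun j _ => by rw [mul_pow, sq_abs]; exact le_of_eq (by ring))
    rw [hE] at h
    refine h.trans ((mul_le_mul_of_nonneg_right hAs hE0).trans_eq (by ring))
  rw [hsplit]
  refine (abs_sub _ _).trans ((add_le_add hsum hint).trans ?_)
  rw [show 4 * E / b₀ = 4 * (E / b₀) by ring]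
  nlinarith [sq_nonneg (P - (Q + R)), sq_nonneg (Q - R)]

/-- Summation by parts for test coefficient vectors. -/
lemma sum_mul_sub_eq_neg_sum_jmp {N p : ℕ} (hN : 1 ≤ N) (hp : 1 ≤ p) {w G : ℕ → ℕ → ℝ}
    (hw : w N p = 0) (hG : ∀ i, 1 ≤ i → i < N → G i (p + 1) = G (i + 1) 1) :
    ∑ i ∈ Finset.Icc 1 N, ∑ j ∈ Finset.Icc 1 p, w i j * (G i (j + 1) - G i j)
      = -∑ i ∈ Finset.Icc 1 N, ∑ j ∈ Finset.Icc 1 p, jmp p w i j * G i j := by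
  have hin : ∀ i, ∀ n, 1 ≤ n → ∑ j ∈ Finset.Icc 1 n, (w i j * (G i (j + 1) - G i j)
      + jmp p w i j * G i j) = w i n * G i (n + 1) - vprev p w i 1 * G i 1 := by
    intro i n hn
    induction n, hn using Nat.le_induction with
    | base => simp [jmp]; ring
    | succ n hn ih =>
      rw [Finset.sum_Icc_succ_top (by omega), ih]
      have : vprev p w i (n + 1) = w i n := by
        rw [vprev, if_neg (by omega), Nat.add_sub_cancel]
      rw [jmp, this]
      ring
  have hout : ∀ n, 1 ≤ n → n ≤ N → ∑ i ∈ Finset.Icc 1 n,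
      (w i p * G i (p + 1) - vprev p w i 1 * G i 1) = w n p * G n (p + 1) := by
    intro n hn
    induction n, hn using Nat.le_induction with
    | base => simp [vprev]
    | succ n hn ih =>
      intro hnN
      rw [Finset.sum_Icc_succ_top (by omega), ih (by omega), hG n hn (by omega)]
      have : vprev p w (n + 1) 1 = w n p := by
        rw [vprev, if_pos rfl, if_neg (by omega), Nat.add_sub_cancel]
      rw [this]
      ring
  rw [eq_neg_iff_add_eq_zero, ← Finset.sum_add_distrib]
  simp only [← Finset.sum_add_distrib]
  rw [Finset.sum_congr rfl fun i _ => hin i p hp, hout N hN le_rfl, hw, zero_mul]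

lemma memLp_deriv_of_flux {N : ℕ} {α βm βp : ℝ} {x : ℕ → ℝ} {v : ℝ → ℝ}
    {q : ℕ → Polynomial ℝ} (hβm : 0 < βm) (hβp : 0 < βp)
    (hq : ∀ i ∈ Finset.Icc 1 N, ∀ t ∈ Ioo (x (i - 1)) (x i), t ≠ α →
      HasDerivAt v ((q i).eval t / betaPW βm βp α t) t) :
    MemLp (deriv v) ⊤ (volume.restrict (Icc (x 0) (x N))) := by
  have hb : 0 < min βm βp := lt_min hβm hβp
  have hM : ∀ i, ∃ M, ∀ t ∈ Icc (x (i - 1)) (x i), ‖(q i).eval t‖ ≤ M := fun i =>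
    isCompact_Icc.exists_bound_of_continuousOn (q i).continuous.continuousOn
  choose M hM using hM
  refine memLp_top_of_bound (measurable_deriv v).aestronglyMeasurable
    (∑ i ∈ Finset.Icc 1 N, |M i| / min βm βp) ?_
  rw [ae_restrict_iff' measurableSet_Icc]
  filter_upwards [((countable_range x).insert α).ae_notMem volume] with t hts htI
  rw [mem_insert_iff, not_or] at hts
  obtain ⟨i, hi, ht⟩ := exists_mem_element
    (lt_of_le_of_ne htI.1 fun h => hts.2 ⟨0, h⟩)
    (lt_of_le_of_ne htI.2 fun h => hts.2 ⟨N, h.symm⟩) hts.2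
  rw [(hq i hi t ht hts.1).deriv]
  refine le_trans ?_ (Finset.single_le_sum (f := fun i => |M i| / min βm βp)
    (fun j _ => by positivity) hi)
  have hβ := min_le_betaPW βm βp α t
  rw [norm_div, Real.norm_of_nonneg (hb.le.trans hβ)]
  exact div_le_div₀ (abs_nonneg _) ((hM i t (Ioo_subset_Icc_self ht)).trans (le_abs_self _)) hb hβ

lemma integral_sq_deriv_le {α βm βp y z : ℝ} {v : ℝ → ℝ} {q : Polynomial ℝ}
    (hβm : 0 < βm) (hβp : 0 < βp) (hyz : y ≤ z)
    (hD : MemLp (deriv v) ⊤ (volume.restrict (Icc y z)))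
    (hq : ∀ t ∈ Ioo y z, t ≠ α → HasDerivAt v (q.eval t / betaPW βm βp α t) t) :
    ∫ t in y..z, deriv v t ^ 2
      ≤ (∫ t in y..z, (q ^ 2).eval t / betaPW βm βp α t) / min βm βp := by
  have hb : 0 < min βm βp := lt_min hβm hβp
  have hy : y ∈ Icc y z := left_mem_Icc.2 hyz
  have hz : z ∈ Icc y z := right_mem_Icc.2 hyz
  have h1 : MemLp (fun t => deriv v t * deriv v t) ⊤ (volume.restrict (Icc y z)) := hD.mul hD
  have hβinv : MemLp (fun t => (betaPW βm βp α t)⁻¹) ⊤ (volume.restrict (Icc y z)) :=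
    memLp_top_of_bound (measurable_betaPW βm βp α).inv.aestronglyMeasurable (min βm βp)⁻¹
      (Filter.Eventually.of_forall fun t => by
        have hβ := min_le_betaPW βm βp α t
        rw [norm_inv, Real.norm_of_nonneg (hb.le.trans hβ)]
        exact inv_anti₀ hb hβ)
  have h2 : MemLp (fun t => (q ^ 2).eval t * (betaPW βm βp α t)⁻¹) ⊤
      (volume.restrict (Icc y z)) := hβinv.mul (q ^ 2).continuous.continuousOn.memLp_top_Icc
  rw [← intervalIntegral.integral_div]
  simp only [sq (deriv v _), div_eq_mul_inv _ (betaPW _ _ _ _)]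
  refine intervalIntegral.integral_mono_ae_restrict hyz (h1.intervalIntegrable_of_subset hy hz)
    ((h2.intervalIntegrable_of_subset hy hz).div_const _) ?_
  refine (ae_restrict_iff' measurableSet_Icc).2 ?_
  filter_upwards [(({y, z, α} : Set ℝ).toFinite.countable).ae_notMem volume] with t hts htI
  simp only [mem_insert_iff, mem_singleton_iff, not_or] at hts
  have ht : t ∈ Ioo y z :=
    ⟨lt_of_le_of_ne htI.1 (Ne.symm hts.1), lt_of_le_of_ne htI.2 hts.2.1⟩
  have hβ := min_le_betaPW βm βp α t
  have hβ0 := hb.trans_le hβ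
  simp only [(hq t ht hts.2.2).deriv, Polynomial.eval_pow]
  rw [show q.eval t / betaPW βm βp α t * (q.eval t / betaPW βm βp α t)
    = q.eval t ^ 2 * (betaPW βm βp α t)⁻¹ / betaPW βm βp α t by field_simp]
  exact div_le_div_of_nonneg_left (by positivity) hb hβ

/-- The data of a function `v` with derivative `D` and discrete fluxes `r` at quadrature nodes `g`,
whose weighted sums reproduce the increments of `v` and control the energy of `D`. -/
structure FluxQuadrature (N p : ℕ) (b₀ : ℝ) (x : ℕ → ℝ) (g A r : ℕ → ℕ → ℝ)
    (v D : ℝ → ℝ) : Prop where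
  lower_pos : 0 < b₀
  one_le_elements : 1 ≤ N
  one_le_degree : 1 ≤ p
  mesh : ∀ i, i < N → x i < x (i + 1)
  continuousOn : ContinuousOn v (Icc (x 0) (x N))
  left_eq_zero : v (x 0) = 0
  right_eq_zero : v (x N) = 0
  node_mem : ∀ i ∈ Finset.Icc 1 N, ∀ j ∈ Finset.Icc 1 p, g i j ∈ Icc (x (i - 1)) (x i)
  node_succ : ∀ i, 1 ≤ i → i < N → g i (p + 1) = g (i + 1) 1
  weight_nonneg : ∀ i ∈ Finset.Icc 1 N, ∀ j ∈ Finset.Icc 1 p, 0 ≤ A i j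
  exists_hasDerivAt : ∃ s : Set ℝ, s.Countable ∧
    ∀ t ∈ Ioo (x 0) (x N) \ s, HasDerivAt v (D t) t
  memLp : MemLp D ⊤ (volume.restrict (Icc (x 0) (x N)))
  sum_flux : ∀ i ∈ Finset.Icc 1 N,
    ∑ j ∈ Finset.Icc 1 p, A i j * r i j = ∫ t in (x (i - 1))..(x i), D t
  sum_weight : ∀ i ∈ Finset.Icc 1 N, ∑ j ∈ Finset.Icc 1 p, A i j ≤ (x i - x (i - 1)) / b₀
  integral_sq_le : ∀ i ∈ Finset.Icc 1 N, ∫ t in (x (i - 1))..(x i), D t ^ 2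
    ≤ (∑ j ∈ Finset.Icc 1 p, A i j * r i j ^ 2) / b₀

/-- The discrete energy `∑ᵢ ∑ⱼ Aᵢⱼ rᵢⱼ²`. -/
noncomputable def fluxEnergy (N p : ℕ) (A r : ℕ → ℕ → ℝ) : ℝ :=
  ∑ i ∈ Finset.Icc 1 N, ∑ j ∈ Finset.Icc 1 p, A i j * r i j ^ 2

/-- The test vector whose jumps are `Aᵢⱼ rᵢⱼ`. -/
noncomputable def fluxTest (x : ℕ → ℝ) (A r : ℕ → ℕ → ℝ) (v : ℝ → ℝ) (i j : ℕ) : ℝ :=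
  v (x (i - 1)) + ∑ l ∈ Finset.Icc 1 j, A i l * r i l

namespace FluxQuadrature

variable {N p : ℕ} {b₀ : ℝ} {x : ℕ → ℝ} {g A r : ℕ → ℕ → ℝ} {v D : ℝ → ℝ}

lemma vertex_mem (H : FluxQuadrature N p b₀ x g A r v D) {i : ℕ} (hi : i ≤ N) :
    x i ∈ Icc (x 0) (x N) :=
  ⟨mesh_le H.mesh (Nat.zero_le i) hi, mesh_le H.mesh hi le_rfl⟩

lemma element_lt (H : FluxQuadrature N p b₀ x g A r v D) {i : ℕ} (hi : i ∈ Finset.Icc 1 N) :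
    x (i - 1) < x i := by
  obtain ⟨h1, h2⟩ := Finset.mem_Icc.1 hi
  simpa [Nat.sub_add_cancel h1] using H.mesh (i - 1) (by omega)

lemma element_subset (H : FluxQuadrature N p b₀ x g A r v D) {i : ℕ}
    (hi : i ∈ Finset.Icc 1 N) : Icc (x (i - 1)) (x i) ⊆ Icc (x 0) (x N) := by
  obtain ⟨h1, h2⟩ := Finset.mem_Icc.1 hi
  exact Icc_subset_Icc (H.vertex_mem (by omega)).1 (H.vertex_mem h2).2

lemma sum_integral (H : FluxQuadrature N p b₀ x g A r v D) {f : ℝ → ℝ}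
    (hf : MemLp f ⊤ (volume.restrict (Icc (x 0) (x N)))) :
    ∑ i ∈ Finset.Icc 1 N, ∫ t in (x (i - 1))..(x i), f t = ∫ t in (x 0)..(x N), f t := by
  rw [sum_Icc_one_eq_sum_range]
  exact intervalIntegral.sum_integral_adjacent_intervals fun i hi =>
    hf.intervalIntegrable_of_subset (H.vertex_mem hi.le) (H.vertex_mem hi)

lemma integral_eq_sub (H : FluxQuadrature N p b₀ x g A r v D) {y z : ℝ}
    (hy : y ∈ Icc (x 0) (x N)) (hz : z ∈ Icc (x 0) (x N)) (hyz : y ≤ z) :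
    ∫ t in y..z, D t = v z - v y := by
  obtain ⟨s, hs, hd⟩ := H.exists_hasDerivAt
  exact integral_eq_of_hasDerivAt_off_countable_of_le v D hyz hs
    (H.continuousOn.mono (Icc_subset_Icc hy.1 hz.2))
    (fun t ht => hd t ⟨Ioo_subset_Ioo hy.1 hz.2 ht.1, ht.2⟩)
    (H.memLp.intervalIntegrable_of_subset hy hz)

lemma element_energy_nonneg (H : FluxQuadrature N p b₀ x g A r v D) {i : ℕ}
    (hi : i ∈ Finset.Icc 1 N) : 0 ≤ ∑ j ∈ Finset.Icc 1 p, A i j * r i j ^ 2 :=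
  Finset.sum_nonneg fun j hj => mul_nonneg (H.weight_nonneg i hi j hj) (sq_nonneg _)

lemma energy_nonneg (H : FluxQuadrature N p b₀ x g A r v D) : 0 ≤ fluxEnergy N p A r :=
  Finset.sum_nonneg fun _ hi => H.element_energy_nonneg hi

lemma memLp_sq (H : FluxQuadrature N p b₀ x g A r v D) :
    MemLp (fun t => D t ^ 2) ⊤ (volume.restrict (Icc (x 0) (x N))) := by
  have : MemLp (fun t => D t * D t) ⊤ (volume.restrict (Icc (x 0) (x N))) := H.memLp.mul H.memLp
  simpa only [sq] using this

lemma integral_sq_le_energy (H : FluxQuadrature N p b₀ x g A r v D) :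
    ∫ t in (x 0)..(x N), D t ^ 2 ≤ fluxEnergy N p A r / b₀ := by
  rw [← H.sum_integral H.memLp_sq, fluxEnergy, Finset.sum_div]
  exact Finset.sum_le_sum H.integral_sq_le

lemma intervalIntegrable_sq (H : FluxQuadrature N p b₀ x g A r v D) :
    IntervalIntegrable (fun t => v t ^ 2) volume (x 0) (x N) := by
  have h := H.continuousOn.pow 2
  rw [← uIcc_of_le (H.vertex_mem (Nat.zero_le N)).2] at h
  exact h.intervalIntegrable

/-- A discrete Poincaré inequality. -/
lemma sq_le_energy (H : FluxQuadrature N p b₀ x g A r v D) {t : ℝ} (ht : t ∈ Icc (x 0) (x N)) :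
    v t ^ 2 ≤ (x N - x 0) * (fluxEnergy N p A r / b₀) := by
  have h0 : x 0 ∈ Icc (x 0) (x N) := H.vertex_mem (Nat.zero_le N)
  have hN : x N ∈ Icc (x 0) (x N) := H.vertex_mem le_rfl
  have h1 : |v t| ≤ ∫ u in (x 0)..(x N), |D u| := by
    have h := H.integral_eq_sub h0 ht ht.1
    rw [H.left_eq_zero, sub_zero] at h
    rw [← h]
    refine (intervalIntegral.abs_integral_le_integral_abs ht.1).trans ?_
    exact intervalIntegral.integral_mono_interval le_rfl ht.1 ht.2
      (Filter.Eventually.of_forall fun t => abs_nonneg _)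
      (H.memLp.intervalIntegrable_of_subset h0 hN).abs
  rw [← sq_abs]
  calc |v t| ^ 2 ≤ (∫ u in (x 0)..(x N), |D u|) ^ 2 := by gcongr
    _ ≤ (x N - x 0) * ∫ u in (x 0)..(x N), D u ^ 2 := sq_integral_abs_le h0.2 H.memLp
    _ ≤ _ := mul_le_mul_of_nonneg_left H.integral_sq_le_energy (sub_nonneg.2 h0.2)

lemma integral_sq_le_energy' (H : FluxQuadrature N p b₀ x g A r v D) :
    ∫ t in (x 0)..(x N), v t ^ 2 ≤ (x N - x 0) ^ 2 * (fluxEnergy N p A r / b₀) := by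
  have h0 : x 0 ∈ Icc (x 0) (x N) := H.vertex_mem (Nat.zero_le N)
  have hN : x N ∈ Icc (x 0) (x N) := H.vertex_mem le_rfl
  refine (intervalIntegral.integral_mono_on h0.2
    H.intervalIntegrable_sq
    intervalIntegrable_const fun t ht => H.sq_le_energy ht).trans_eq ?_
  rw [intervalIntegral.integral_const, smul_eq_mul]
  ring

lemma integral_mul_eq_zero (H : FluxQuadrature N p b₀ x g A r v D) :
    ∫ t in (x 0)..(x N), v t * D t = 0 := by
  obtain ⟨s, hs, hd⟩ := H.exists_hasDerivAt
  have h0 : x 0 ∈ Icc (x 0) (x N) := H.vertex_mem (Nat.zero_le N)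
  have hN : x N ∈ Icc (x 0) (x N) := H.vertex_mem le_rfl
  have hm : MemLp (fun t => v t * D t) ⊤ (volume.restrict (Icc (x 0) (x N))) :=
    H.memLp.mul H.continuousOn.memLp_top_Icc
  have h := integral_eq_of_hasDerivAt_off_countable_of_le (fun t => v t ^ 2 / 2)
    (fun t => v t * D t) h0.2 hs ((H.continuousOn.pow 2).div_const 2)
    (fun t ht => (((hd t ht).fun_pow 2).div_const 2).congr_deriv (by
      push_cast
      ring))
    (hm.intervalIntegrable_of_subset h0 hN)
  rw [h, H.left_eq_zero, H.right_eq_zero]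
  simp

lemma fluxTest_last (H : FluxQuadrature N p b₀ x g A r v D) {i : ℕ}
    (hi : i ∈ Finset.Icc 1 N) : fluxTest x A r v i p = v (x i) := by
  have hi' := Finset.mem_Icc.1 hi
  rw [fluxTest, H.sum_flux i hi, H.integral_eq_sub (H.vertex_mem (by omega))
    (H.vertex_mem hi'.2) (H.element_lt hi).le]
  ring

lemma jmp_fluxTest (H : FluxQuadrature N p b₀ x g A r v D) {i j : ℕ}
    (hi : i ∈ Finset.Icc 1 N) (hj : j ∈ Finset.Icc 1 p) :
    jmp p (fluxTest x A r v) i j = A i j * r i j := by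
  obtain ⟨hi1, hiN⟩ := Finset.mem_Icc.1 hi
  obtain ⟨hj1, hjp⟩ := Finset.mem_Icc.1 hj
  have hprev : vprev p (fluxTest x A r v) i j
      = v (x (i - 1)) + ∑ l ∈ Finset.Icc 1 (j - 1), A i l * r i l := by
    unfold vprev
    split_ifs with h1 h2
    · subst h1 h2
      simp [H.left_eq_zero]
    · subst h1
      rw [H.fluxTest_last (Finset.mem_Icc.2 ⟨by omega, by omega⟩)]
      simp
    · rfl
  obtain ⟨n, rfl⟩ := Nat.exists_eq_add_of_le' hj1
  rw [jmp, hprev, fluxTest, Finset.sum_Icc_succ_top (by omega), Nat.add_sub_cancel]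
  ring

/-- The lower-order part of the bilinear form is consistent up to one power of the mesh size. -/
lemma integral_mul_sub_le_sum (H : FluxQuadrature N p b₀ x g A r v D) (γ c : ℝ) {h : ℝ}
    (hh : ∀ i ∈ Finset.Icc 1 N, x i - x (i - 1) ≤ h) :
    (∫ t in (x 0)..(x N), v t * (γ * D t + c * v t))
      - h / 2 * ((∫ t in (x 0)..(x N), (γ * D t + c * v t) ^ 2) + 4 * fluxEnergy N p A r / b₀)
    ≤ ∑ i ∈ Finset.Icc 1 N, ∑ j ∈ Finset.Icc 1 (if i < N then p else p - 1),
        fluxTest x A r v i j * ∫ t in (g i j)..(g i (j + 1)), (γ * D t + c * v t) := by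
  have h0 : x 0 ∈ Icc (x 0) (x N) := H.vertex_mem (Nat.zero_le N)
  have hN : x N ∈ Icc (x 0) (x N) := H.vertex_mem le_rfl
  set w := fluxTest x A r v with hw
  set f : ℝ → ℝ := fun t => γ * D t + c * v t with hf
  have hvm := H.continuousOn.memLp_top_Icc
  have hfm : MemLp f ⊤ (volume.restrict (Icc (x 0) (x N))) :=
    (H.memLp.const_mul γ).add (hvm.const_mul c)
  have hff : MemLp (fun t => f t * f t) ⊤ (volume.restrict (Icc (x 0) (x N))) := hfm.mul hfm
  have hf2 : MemLp (fun t => f t ^ 2) ⊤ (volume.restrict (Icc (x 0) (x N))) := by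
    simpa only [sq] using hff
  set V : ℝ → ℝ := fun t => ∫ u in (x 0)..t, v u with hV
  set F : ℝ → ℝ := fun t => γ * v t + c * V t with hF
  have hVc : ContinuousOn V (Icc (x 0) (x N)) := by
    have := intervalIntegral.continuousOn_primitive_interval (a := x 0) (b := x N) (f := v)
      (μ := volume) (by rw [uIcc_of_le h0.2]; exact hvm.integrable le_top)
    rwa [uIcc_of_le h0.2] at this
  have hFc : ContinuousOn F (Icc (x 0) (x N)) :=
    (continuousOn_const.mul H.continuousOn).add (continuousOn_const.mul hVc)
  have hVd : ∀ t ∈ Ioo (x 0) (x N), HasDerivAt V (v t) t := fun t ht =>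
    intervalIntegral.integral_hasDerivAt_right
      (hvm.intervalIntegrable_of_subset h0 (Ioo_subset_Icc_self ht))
      ((H.continuousOn.mono Ioo_subset_Icc_self).stronglyMeasurableAtFilter isOpen_Ioo t ht)
      (H.continuousOn.continuousAt (Icc_mem_nhds ht.1 ht.2))
  obtain ⟨s, hs, hd⟩ := H.exists_hasDerivAt
  have hFd : ∀ t ∈ Ioo (x 0) (x N) \ s, HasDerivAt F (f t) t := fun t ht =>
    ((hd t ht).const_mul γ).add ((hVd t ht.1).const_mul c)
  have hFle : ∀ y ∈ Icc (x 0) (x N), ∀ z ∈ Icc (x 0) (x N), y ≤ z →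
      ∫ t in y..z, f t = F z - F y := fun y hy z hz hyz =>
    integral_eq_of_hasDerivAt_off_countable_of_le F f hyz hs
      (hFc.mono (Icc_subset_Icc hy.1 hz.2))
      (fun t ht => hFd t ⟨Ioo_subset_Ioo hy.1 hz.2 ht.1, ht.2⟩)
      (hfm.intervalIntegrable_of_subset hy hz)
  have hFint : ∀ y ∈ Icc (x 0) (x N), ∀ z ∈ Icc (x 0) (x N),
      ∫ t in y..z, f t = F z - F y := fun y hy z hz => by
    rcases le_total y z with hyz | hyz
    · exact hFle y hy z hz hyz
    · rw [intervalIntegral.integral_symm, hFle z hz y hy hyz]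
      ring
  have hDF : MemLp (fun t => D t * F t) ⊤ (volume.restrict (Icc (x 0) (x N))) :=
    hFc.memLp_top_Icc.mul H.memLp
  have hvf : MemLp (fun t => v t * f t) ⊤ (volume.restrict (Icc (x 0) (x N))) := hfm.mul hvm
  have hparts : (∫ t in (x 0)..(x N), D t * F t) + ∫ t in (x 0)..(x N), v t * f t = 0 := by
    rw [← intervalIntegral.integral_add (hDF.intervalIntegrable_of_subset h0 hN)
      (hvf.intervalIntegrable_of_subset h0 hN),
      integral_eq_of_hasDerivAt_off_countable_of_le (fun t => v t * F t)
        (fun t => D t * F t + v t * f t) h0.2 hs (H.continuousOn.mul hFc)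
        (fun t ht => (hd t ht).mul (hFd t ht))
        ((hDF.add hvf).intervalIntegrable_of_subset h0 hN),
      H.left_eq_zero, H.right_eq_zero]
    ring
  have hwN : w N p = 0 := by
    rw [hw, H.fluxTest_last (Finset.mem_Icc.2 ⟨H.one_le_elements, le_rfl⟩), H.right_eq_zero]
  have hnode : ∀ i ∈ Finset.Icc 1 N, ∀ j ∈ Finset.Icc 1 p, g i j ∈ Icc (x 0) (x N) :=
    fun i hi j hj => H.element_subset hi (H.node_mem i hi j hj)
  have hsum : ∑ i ∈ Finset.Icc 1 N, ∑ j ∈ Finset.Icc 1 (if i < N then p else p - 1),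
      w i j * ∫ t in (g i j)..(g i (j + 1)), f t
      = -∑ i ∈ Finset.Icc 1 N, ∑ j ∈ Finset.Icc 1 p, A i j * r i j * F (g i j) := by
    have hjmp : ∑ i ∈ Finset.Icc 1 N, ∑ j ∈ Finset.Icc 1 p, A i j * r i j * F (g i j)
        = ∑ i ∈ Finset.Icc 1 N, ∑ j ∈ Finset.Icc 1 p, jmp p w i j * F (g i j) :=
      Finset.sum_congr rfl fun i hi => Finset.sum_congr rfl fun j hj => by
        rw [hw, H.jmp_fluxTest hi hj]
    rw [hjmp, ← sum_mul_sub_eq_neg_sum_jmp (G := fun i j => F (g i j)) H.one_le_elements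
      H.one_le_degree hwN fun i h1 h2 => by rw [H.node_succ i h1 h2]]
    refine Finset.sum_congr rfl fun i hi => ?_
    obtain ⟨hi1, hiN⟩ := Finset.mem_Icc.1 hi
    have hterm : ∀ j ∈ Finset.Icc 1 p, (i < N ∨ j < p) →
        w i j * (∫ t in (g i j)..(g i (j + 1)), f t)
          = w i j * (F (g i (j + 1)) - F (g i j)) := fun j hj hor => by
      obtain ⟨hj1, hjp⟩ := Finset.mem_Icc.1 hj
      rw [hFint _ (hnode i hi j hj)]
      rcases hjp.lt_or_eq with hlt | rfl
      · exact hnode i hi (j + 1) (Finset.mem_Icc.2 ⟨by omega, hlt⟩)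
      · rw [H.node_succ i hi1 (by omega)]
        exact hnode (i + 1) (Finset.mem_Icc.2 ⟨by omega, by omega⟩) 1
          (Finset.mem_Icc.2 ⟨le_rfl, hj1⟩)
    split_ifs with hlt
    · exact Finset.sum_congr rfl fun j hj => hterm j hj (Or.inl hlt)
    · obtain rfl : i = N := by omega
      obtain ⟨n, rfl⟩ := Nat.exists_eq_add_of_le' H.one_le_degree
      rw [Nat.add_sub_cancel, Finset.sum_Icc_succ_top (by omega), hwN, zero_mul, add_zero]
      refine Finset.sum_congr rfl fun j hj => hterm j ?_ (Or.inr ?_)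
      · rw [Finset.mem_Icc] at hj ⊢
        omega
      · rw [Finset.mem_Icc] at hj
        omega
  have helem : ∀ i ∈ Finset.Icc 1 N,
      ∑ j ∈ Finset.Icc 1 p, A i j * r i j * F (g i j) - ∫ t in (x (i - 1))..(x i), D t * F t
        ≤ h / 2 * ((∫ t in (x (i - 1))..(x i), f t ^ 2)
          + 4 * (∑ j ∈ Finset.Icc 1 p, A i j * r i j ^ 2) / b₀) := fun i hi => by
    have hsub := H.element_subset hi
    have hle := (H.element_lt hi).le
    have hm : volume.restrict (Icc (x (i - 1)) (x i)) ≤ volume.restrict (Icc (x 0) (x N)) :=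
      Measure.restrict_mono hsub le_rfl
    refine (le_abs_self _).trans ((abs_quadrature_sub_integral_le (f := f) (b₀ := b₀) _ hle
      (H.memLp.mono_measure hm) (hfm.mono_measure hm) (hFc.mono hsub)
      (fun t ht => (hFint _ (hsub (left_mem_Icc.2 hle)) t (hsub ht)).symm)
      (H.node_mem i hi) (H.weight_nonneg i hi) (H.sum_flux i hi) (H.sum_weight i hi) rfl
      (H.integral_sq_le i hi)).trans ?_)
    refine mul_le_mul_of_nonneg_right (by linarith [hh i hi]) (add_nonneg ?_ ?_)
    · exact intervalIntegral.integral_nonneg hle fun t _ => sq_nonneg _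
    · exact div_nonneg (mul_nonneg (by norm_num) (H.element_energy_nonneg hi)) H.lower_pos.le
  have htotal := Finset.sum_le_sum helem
  rw [Finset.sum_sub_distrib, H.sum_integral hDF, ← Finset.mul_sum, Finset.sum_add_distrib,
    H.sum_integral hf2, ← Finset.sum_div, ← Finset.mul_sum] at htotal
  rw [hsum]
  change _ ≤ h / 2 * (_ + 4 * fluxEnergy N p A r / b₀) at htotal
  linarith

/-- The consistency error is dominated by the energy, so the form is coercive on fine meshes. -/
lemma energy_mul_le_form (H : FluxQuadrature N p b₀ x g A r v D) (γ : ℝ) {c h : ℝ} (hc : 0 ≤ c)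
    (hh : ∀ i ∈ Finset.Icc 1 N, x i - x (i - 1) ≤ h) :
    fluxEnergy N p A r
        * (1 - h / 2 * ((2 * γ ^ 2 + 2 * c ^ 2 * (x N - x 0) ^ 2 + 4) / b₀))
      ≤ (∑ i ∈ Finset.Icc 1 N, ∑ j ∈ Finset.Icc 1 p, jmp p (fluxTest x A r v) i j * r i j)
        + ∑ i ∈ Finset.Icc 1 N, ∑ j ∈ Finset.Icc 1 (if i < N then p else p - 1),
          fluxTest x A r v i j * ∫ t in (g i j)..(g i (j + 1)), (γ * D t + c * v t) := by
  have h0 : x 0 ∈ Icc (x 0) (x N) := H.vertex_mem (Nat.zero_le N)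
  have hN : x N ∈ Icc (x 0) (x N) := H.vertex_mem le_rfl
  have hh0 : 0 ≤ h := by
    have h1 : 1 ∈ Finset.Icc 1 N := Finset.mem_Icc.2 ⟨le_rfl, H.one_le_elements⟩
    linarith [hh 1 h1, H.element_lt h1]
  have hmain : ∑ i ∈ Finset.Icc 1 N, ∑ j ∈ Finset.Icc 1 p, jmp p (fluxTest x A r v) i j * r i j
      = fluxEnergy N p A r :=
    Finset.sum_congr rfl fun i hi => Finset.sum_congr rfl fun j hj => by
      rw [H.jmp_fluxTest hi hj]
      ring
  have hvm := H.continuousOn.memLp_top_Icc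
  have hvD : MemLp (fun t => v t * D t) ⊤ (volume.restrict (Icc (x 0) (x N))) := H.memLp.mul hvm
  have hv2 := H.intervalIntegrable_sq
  have hD2 := H.memLp_sq.intervalIntegrable_of_subset h0 hN
  have hpos : 0 ≤ ∫ t in (x 0)..(x N), v t * (γ * D t + c * v t) := by
    have : ∫ t in (x 0)..(x N), v t * (γ * D t + c * v t)
        = ∫ t in (x 0)..(x N), (γ * (v t * D t) + c * v t ^ 2) := by
      congr 1
      ext t
      ring
    rw [this, intervalIntegral.integral_add
      ((hvD.intervalIntegrable_of_subset h0 hN).const_mul γ) (hv2.const_mul c),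
      intervalIntegral.integral_const_mul, intervalIntegral.integral_const_mul,
      H.integral_mul_eq_zero, mul_zero, zero_add]
    exact mul_nonneg hc (intervalIntegral.integral_nonneg h0.2 fun t _ => sq_nonneg _)
  have hfm : MemLp (fun t => γ * D t + c * v t) ⊤ (volume.restrict (Icc (x 0) (x N))) :=
    (H.memLp.const_mul γ).add (hvm.const_mul c)
  have hff : MemLp (fun t => (γ * D t + c * v t) * (γ * D t + c * v t)) ⊤
    (volume.restrict (Icc (x 0) (x N))) := hfm.mul hfm
  have hsq : ∫ t in (x 0)..(x N), (γ * D t + c * v t) ^ 2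
      ≤ (2 * γ ^ 2 + 2 * c ^ 2 * (x N - x 0) ^ 2) * (fluxEnergy N p A r / b₀) := by
    calc ∫ t in (x 0)..(x N), (γ * D t + c * v t) ^ 2
        ≤ ∫ t in (x 0)..(x N), (2 * γ ^ 2 * D t ^ 2 + 2 * c ^ 2 * v t ^ 2) := by
          refine intervalIntegral.integral_mono_on h0.2
            (by simpa only [sq] using hff.intervalIntegrable_of_subset h0 hN)
            ((hD2.const_mul _).add (hv2.const_mul _)) fun t _ => ?_
          nlinarith [sq_nonneg (γ * D t - c * v t)]
      _ = 2 * γ ^ 2 * (∫ t in (x 0)..(x N), D t ^ 2)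
          + 2 * c ^ 2 * ∫ t in (x 0)..(x N), v t ^ 2 := by
          rw [intervalIntegral.integral_add (hD2.const_mul _) (hv2.const_mul _),
            intervalIntegral.integral_const_mul, intervalIntegral.integral_const_mul]
      _ ≤ 2 * γ ^ 2 * (fluxEnergy N p A r / b₀)
          + 2 * c ^ 2 * ((x N - x 0) ^ 2 * (fluxEnergy N p A r / b₀)) := by
          gcongr
          exacts [H.integral_sq_le_energy, H.integral_sq_le_energy']
      _ = _ := by ring
  have hlow := H.integral_mul_sub_le_sum γ c hh
  rw [hmain]
  have hmul := mul_le_mul_of_nonneg_left hsq (by positivity : 0 ≤ h / 2)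
  have e : fluxEnergy N p A r
        * (1 - h / 2 * ((2 * γ ^ 2 + 2 * c ^ 2 * (x N - x 0) ^ 2 + 4) / b₀))
      = fluxEnergy N p A r
        - h / 2 * ((2 * γ ^ 2 + 2 * c ^ 2 * (x N - x 0) ^ 2) * (fluxEnergy N p A r / b₀))
        - h / 2 * (4 * fluxEnergy N p A r / b₀) := by ring
  rw [e]
  linarith

lemma normTpSq_fluxTest_le (H : FluxQuadrature N p b₀ x g A r v D) :
    normTpSq N p x (fluxTest x A r v)
      ≤ (1 / b₀ + p * (x N - x 0) * (4 * (x N - x 0) / b₀)) * fluxEnergy N p A r := by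
  have hb := H.lower_pos
  have hE := H.energy_nonneg
  have hjump : ∑ i ∈ Finset.Icc 1 N, ∑ j ∈ Finset.Icc 1 p,
      (x i - x (i - 1))⁻¹ * (jmp p (fluxTest x A r v) i j) ^ 2
      ≤ 1 / b₀ * fluxEnergy N p A r := by
    rw [fluxEnergy, Finset.mul_sum]
    refine Finset.sum_le_sum fun i hi => ?_
    rw [Finset.mul_sum]
    refine Finset.sum_le_sum fun j hj => ?_
    have hpos : 0 < x i - x (i - 1) := sub_pos.2 (H.element_lt hi)
    have hA := H.weight_nonneg i hi j hj
    have hAle : A i j ≤ (x i - x (i - 1)) / b₀ :=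
      (Finset.single_le_sum (f := fun j => A i j) (H.weight_nonneg i hi) hj).trans
        (H.sum_weight i hi)
    rw [H.jmp_fluxTest hi hj]
    calc (x i - x (i - 1))⁻¹ * (A i j * r i j) ^ 2
        = (x i - x (i - 1))⁻¹ * A i j * (A i j * r i j ^ 2) := by ring
      _ ≤ (x i - x (i - 1))⁻¹ * ((x i - x (i - 1)) / b₀) * (A i j * r i j ^ 2) := by gcongr
      _ = 1 / b₀ * (A i j * r i j ^ 2) := by field_simp
  have hval : ∀ i ∈ Finset.Icc 1 N, ∀ j ∈ Finset.Icc 1 p,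
      fluxTest x A r v i j ^ 2 ≤ 4 * (x N - x 0) / b₀ * fluxEnergy N p A r := by
    intro i hi j hj
    obtain ⟨hi1, hiN⟩ := Finset.mem_Icc.1 hi
    have hsub : Finset.Icc 1 j ⊆ Finset.Icc 1 p :=
      Finset.Icc_subset_Icc_right (Finset.mem_Icc.1 hj).2
    have hlen : x i - x (i - 1) ≤ x N - x 0 := by
      linarith [(H.vertex_mem hiN).2, (H.vertex_mem (show i - 1 ≤ N by omega)).1]
    have h1 := Finset.sum_sq_le_sum_mul_sum_of_sq_le_mul (Finset.Icc 1 j)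
      (r := fun l => A i l * r i l) (f := A i) (g := fun l => A i l * r i l ^ 2)
      (fun l hl => H.weight_nonneg i hi l (hsub hl))
      (fun l hl => mul_nonneg (H.weight_nonneg i hi l (hsub hl)) (sq_nonneg _))
      (fun l _ => le_of_eq (by ring))
    have h2 : ∑ l ∈ Finset.Icc 1 j, A i l ≤ (x N - x 0) / b₀ :=
      (Finset.sum_le_sum_of_subset_of_nonneg hsub
        fun l hl _ => H.weight_nonneg i hi l hl).trans
        ((H.sum_weight i hi).trans (div_le_div_of_nonneg_right hlen hb.le))
    have h3 : ∑ l ∈ Finset.Icc 1 j, A i l * r i l ^ 2 ≤ fluxEnergy N p A r :=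
      (Finset.sum_le_sum_of_subset_of_nonneg hsub
        fun l hl _ => mul_nonneg (H.weight_nonneg i hi l hl) (sq_nonneg _)).trans
        (Finset.single_le_sum (f := fun i => ∑ l ∈ Finset.Icc 1 p, A i l * r i l ^ 2)
          (fun i hi => H.element_energy_nonneg hi) hi)
    have h4 : 0 ≤ ∑ l ∈ Finset.Icc 1 j, A i l * r i l ^ 2 :=
      Finset.sum_nonneg fun l hl => mul_nonneg (H.weight_nonneg i hi l (hsub hl)) (sq_nonneg _)
    have h5 : 0 ≤ (x N - x 0) / b₀ :=
      div_nonneg (sub_nonneg.2 (H.vertex_mem le_rfl).1) hb.le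
    have h6 := h1.trans (mul_le_mul h2 h3 h4 h5)
    have h7 := H.sq_le_energy (H.vertex_mem (show i - 1 ≤ N by omega))
    rw [fluxTest]
    have e : 4 * (x N - x 0) / b₀ * fluxEnergy N p A r
        = 2 * ((x N - x 0) * (fluxEnergy N p A r / b₀))
          + 2 * ((x N - x 0) / b₀ * fluxEnergy N p A r) := by ring
    rw [e]
    nlinarith [sq_nonneg (v (x (i - 1)) - ∑ l ∈ Finset.Icc 1 j, A i l * r i l)]
  have hzero : ∑ i ∈ Finset.Icc 1 N, ∑ j ∈ Finset.Icc 1 (if i < N then p else p - 1),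
      (x i - x (i - 1)) * (fluxTest x A r v i j) ^ 2
      ≤ p * (x N - x 0) * (4 * (x N - x 0) / b₀) * fluxEnergy N p A r := by
    calc ∑ i ∈ Finset.Icc 1 N, ∑ j ∈ Finset.Icc 1 (if i < N then p else p - 1),
          (x i - x (i - 1)) * (fluxTest x A r v i j) ^ 2
        ≤ ∑ i ∈ Finset.Icc 1 N, ∑ j ∈ Finset.Icc 1 p,
          (x i - x (i - 1)) * (4 * (x N - x 0) / b₀ * fluxEnergy N p A r) := by
          refine Finset.sum_le_sum fun i hi => ?_
          have hpos : 0 ≤ x i - x (i - 1) := sub_nonneg.2 (H.element_lt hi).le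
          refine (Finset.sum_le_sum_of_subset_of_nonneg (Finset.Icc_subset_Icc_right ?_)
            fun j _ _ => mul_nonneg hpos (sq_nonneg _)).trans (Finset.sum_le_sum fun j hj =>
              mul_le_mul_of_nonneg_left (hval i hi j hj) hpos)
          split_ifs <;> omega
      _ = _ := by
          simp only [Finset.sum_const, Nat.card_Icc, Nat.add_sub_cancel, nsmul_eq_mul,
            ← Finset.sum_mul, ← Finset.mul_sum, sum_Icc_one_sub]
          ring
  rw [normTpSq, add_mul]
  exact add_le_add hjump hzero

lemma mul_energy_le_normTpSq (H : FluxQuadrature N p b₀ x g A r v D) {κ : ℝ}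
    (hκ : ∀ i ∈ Finset.Icc 1 N, ∀ j ∈ Finset.Icc 1 p, κ * (x i - x (i - 1)) ≤ A i j) :
    κ * fluxEnergy N p A r ≤ normTpSq N p x (fluxTest x A r v) := by
  rw [normTpSq]
  refine le_add_of_le_of_nonneg ?_ (Finset.sum_nonneg fun i hi => Finset.sum_nonneg fun j _ =>
    mul_nonneg (sub_nonneg.2 (H.element_lt hi).le) (sq_nonneg _))
  rw [fluxEnergy, Finset.mul_sum]
  refine Finset.sum_le_sum fun i hi => ?_
  rw [Finset.mul_sum]
  refine Finset.sum_le_sum fun j hj => ?_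
  have hpos : 0 < x i - x (i - 1) := sub_pos.2 (H.element_lt hi)
  have hA := H.weight_nonneg i hi j hj
  have hκA := hκ i hi j hj
  rw [H.jmp_fluxTest hi hj]
  calc κ * (A i j * r i j ^ 2)
      = (x i - x (i - 1))⁻¹ * (κ * (x i - x (i - 1))) * (A i j * r i j ^ 2) := by field_simp
    _ ≤ (x i - x (i - 1))⁻¹ * A i j * (A i j * r i j ^ 2) := by gcongr
    _ = (x i - x (i - 1))⁻¹ * (A i j * r i j) ^ 2 := by ring

lemma energy_pos (H : FluxQuadrature N p b₀ x g A r v D)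
    (hv : ¬ ∀ t ∈ Icc (x 0) (x N), v t = 0) : 0 < fluxEnergy N p A r := by
  refine lt_of_le_of_ne H.energy_nonneg fun h => hv fun t ht => ?_
  have := H.sq_le_energy ht
  rw [← h, zero_div, mul_zero] at this
  exact pow_eq_zero_iff two_ne_zero |>.1 (le_antisymm this (sq_nonneg _))

lemma integral_sq_add_sq_le (H : FluxQuadrature N p b₀ x g A r v D) :
    ∫ t in (x 0)..(x N), (D t ^ 2 + v t ^ 2)
      ≤ (1 + (x N - x 0) ^ 2) / b₀ * fluxEnergy N p A r := by
  have h0 : x 0 ∈ Icc (x 0) (x N) := H.vertex_mem (Nat.zero_le N)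
  have hN : x N ∈ Icc (x 0) (x N) := H.vertex_mem le_rfl
  rw [intervalIntegral.integral_add (H.memLp_sq.intervalIntegrable_of_subset h0 hN)
    H.intervalIntegrable_sq]
  refine (add_le_add H.integral_sq_le_energy H.integral_sq_le_energy').trans_eq ?_
  ring

end FluxQuadrature

lemma integral_flux_div_eq {α βm βp y z : ℝ} {v : ℝ → ℝ} {q : Polynomial ℝ} (hyz : y ≤ z)
    (hq : ∀ t ∈ Ioo y z, t ≠ α → HasDerivAt v (q.eval t / betaPW βm βp α t) t) :
    ∫ t in y..z, q.eval t / betaPW βm βp α t = ∫ t in y..z, deriv v t := by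
  refine intervalIntegral.integral_congr_ae ?_
  filter_upwards [(({z, α} : Set ℝ).toFinite.countable).ae_notMem volume] with t hts htI
  simp only [mem_insert_iff, mem_singleton_iff, not_or] at hts
  rw [uIoc_of_le hyz] at htI
  exact (hq t ⟨htI.1, lt_of_le_of_ne htI.2 hts.1⟩ hts.2).deriv.symm

lemma integral_one_div_betaPW_le {α βm βp y z : ℝ} (hβm : 0 < βm) (hβp : 0 < βp) (hyz : y ≤ z) :
    ∫ t in y..z, 1 / betaPW βm βp α t ≤ (z - y) / min βm βp := by
  have hb : 0 < min βm βp := lt_min hβm hβp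
  have h : ∀ t ∈ uIoc y z, ‖1 / betaPW βm βp α t‖ ≤ 1 / min βm βp := fun t _ => by
    have hβ := min_le_betaPW βm βp α t
    rw [Real.norm_of_nonneg (one_div_nonneg.2 (hb.le.trans hβ))]
    exact one_div_le_one_div_of_le hb hβ
  refine (le_abs_self _).trans ((intervalIntegral.norm_integral_le_of_norm_le_const h).trans_eq ?_)
  rw [abs_of_nonneg (sub_nonneg.2 hyz)]
  ring

lemma MemUT.fluxQuadrature {p N k : ℕ} {a b α βm βp : ℝ} {x : ℕ → ℝ} {g A : ℕ → ℕ → ℝ}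
    {v : ℝ → ℝ} (hv : MemUT p N k a b α βm βp x v) (hp : 1 ≤ p) (hβm : 0 < βm) (hβp : 0 < βp)
    (hN : 1 ≤ N) (hk : 1 ≤ k) (hkN : k ≤ N) (ha : x 0 = a) (hb : x N = b)
    (hx : ∀ i, i < N → x i < x (i + 1)) (hα₁ : x (k - 1) < α) (hα₂ : α < x k)
    (hg : ∀ i ∈ Finset.Icc 1 N, ∀ j ∈ Finset.Icc 1 p,
      x (i - 1) < g i j ∧ g i j < x i ∧ g i j ≠ α)
    (hgs : ∀ i, 1 ≤ i → i < N → g i (p + 1) = g (i + 1) 1)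
    (hA : ∀ i ∈ Finset.Icc 1 N, ∀ j ∈ Finset.Icc 1 p, 0 < A i j)
    (hquad : ∀ i ∈ Finset.Icc 1 N, ∀ F : Polynomial ℝ, F.natDegree ≤ 2 * p - 1 →
      ∑ j ∈ Finset.Icc 1 p, A i j * F.eval (g i j)
        = ∫ t in (x (i - 1))..(x i), F.eval t / betaPW βm βp α t) :
    FluxQuadrature N p (min βm βp) x g A
      (fun i j => betaPW βm βp α (g i j) * deriv v (g i j)) v (deriv v) := by
  subst ha hb
  have hex : ∀ i, ∃ q : Polynomial ℝ, i ∈ Finset.Icc 1 N → q.natDegree ≤ p - 1 ∧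
      ∀ t ∈ Ioo (x (i - 1)) (x i), t ≠ α → HasDerivAt v (q.eval t / betaPW βm βp α t) t := by
    intro i
    by_cases hi : i ∈ Finset.Icc 1 N
    · obtain ⟨q, hq⟩ := hv.exists_flux hβm hβp hk hkN hx hα₁ hα₂ hi
      exact ⟨q, fun _ => hq⟩
    · exact ⟨0, fun h => absurd h hi⟩
  choose q hq using hex
  have hD := memLp_deriv_of_flux hβm hβp fun i hi => (hq i hi).2
  have hlt : ∀ i ∈ Finset.Icc 1 N, x (i - 1) < x i := fun i hi => by
    obtain ⟨h1, h2⟩ := Finset.mem_Icc.1 hi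
    simpa [Nat.sub_add_cancel h1] using hx (i - 1) (by omega)
  have hflux : ∀ i ∈ Finset.Icc 1 N, ∀ j ∈ Finset.Icc 1 p,
      betaPW βm βp α (g i j) * deriv v (g i j) = (q i).eval (g i j) := fun i hi j hj => by
    obtain ⟨h1, h2, h3⟩ := hg i hi j hj
    rw [((hq i hi).2 _ ⟨h1, h2⟩ h3).deriv]
    exact mul_div_cancel₀ _ ((lt_min hβm hβp).trans_le (min_le_betaPW βm βp α _)).ne'
  refine
    { lower_pos := lt_min hβm hβp
      one_le_elements := hN
      one_le_degree := hp
      mesh := hx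
      continuousOn := hv.1
      left_eq_zero := hv.2.1
      right_eq_zero := hv.2.2.1
      node_mem := fun i hi j hj => ⟨(hg i hi j hj).1.le, (hg i hi j hj).2.1.le⟩
      node_succ := hgs
      weight_nonneg := fun i hi j hj => (hA i hi j hj).le
      exists_hasDerivAt := ⟨insert α (range x), (countable_range x).insert α, fun t ht => ?_⟩
      memLp := hD
      sum_flux := fun i hi => ?_
      sum_weight := fun i hi => ?_
      integral_sq_le := fun i hi => ?_ }
  · obtain ⟨htI, hts⟩ := ht
    rw [mem_insert_iff, not_or] at hts
    obtain ⟨i, hi, hti⟩ := exists_mem_element htI.1 htI.2 hts.2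
    exact ((hq i hi).2 t hti hts.1).differentiableAt.hasDerivAt
  · rw [← integral_flux_div_eq (hlt i hi).le (hq i hi).2,
      ← hquad i hi (q i) ((hq i hi).1.trans (by omega))]
    exact Finset.sum_congr rfl fun j hj => by rw [hflux i hi j hj]
  · have h := hquad i hi 1 (by simp)
    simp only [Polynomial.eval_one, mul_one] at h
    rw [h]
    exact integral_one_div_betaPW_le hβm hβp (hlt i hi).le
  · have hi' := Finset.mem_Icc.1 hi
    have hsub : Icc (x (i - 1)) (x i) ⊆ Icc (x 0) (x N) :=
      Icc_subset_Icc (mesh_le hx (Nat.zero_le _) (by omega)) (mesh_le hx hi'.2 le_rfl)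
    refine (integral_sq_deriv_le hβm hβp (hlt i hi).le
      (hD.mono_measure (Measure.restrict_mono hsub le_rfl)) (hq i hi).2).trans_eq ?_
    have hdeg : (q i ^ 2).natDegree ≤ 2 * p - 1 :=
      (Polynomial.natDegree_pow_le_of_le 2 (hq i hi).1).trans (by omega)
    rw [← hquad i hi _ hdeg]
    congr 1
    exact Finset.sum_congr rfl fun j hj => by rw [hflux i hi j hj, Polynomial.eval_pow]

/-- for `c > 0` and `A_{i,j} ≥ κ hᵢ`, there exist `h₀ > 0` and `c₀ > 0`,
depending only on `p`, `β⁻`, `β⁺`, `γ`, `c`, `κ` and `b−a`, such that whenever `h ≤ h₀` the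
discrete inf-sup condition holds: for every nonzero `v ∈ U_T` there is a test coefficient
vector `w` with `‖w‖_{T'} > 0` and `a(v,w) ≥ c₀ ‖v‖_G ‖w‖_{T'}`. -/
theorem stmt_11 (p : ℕ) (hp : 1 ≤ p) (βm βp γ c κ d : ℝ)
    (hβm : 0 < βm) (hβp : 0 < βp) (hc : 0 < c) (hκ : 0 < κ) (hd : 0 < d) :
    ∃ h₀ c₀ : ℝ, 0 < h₀ ∧ 0 < c₀ ∧
    (∀ (N k : ℕ) (a b α hm : ℝ) (x : ℕ → ℝ) (g A : ℕ → ℕ → ℝ),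
    b - a = d →
    1 ≤ N →
    1 ≤ k →
    k ≤ N →
    a < b →
    x 0 = a →
    x N = b →
    (∀ i, i < N → x i < x (i + 1)) →
    x (k - 1) < α →
    α < x k →
    (∀ i ∈ Finset.Icc 1 N, ∀ j ∈ Finset.Icc 1 p,
      x (i - 1) < g i j ∧ g i j < x i ∧ g i j ≠ α) →
    (∀ i ∈ Finset.Icc 1 N, ∀ j, 1 ≤ j → j < p → g i j < g i (j + 1)) →
    (∀ i, 1 ≤ i → i < N → g i (p + 1) = g (i + 1) 1) →
    (∀ i ∈ Finset.Icc 1 N, ∀ j ∈ Finset.Icc 1 p, 0 < A i j) →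
    (∀ i ∈ Finset.Icc 1 N, ∀ F : Polynomial ℝ, F.natDegree ≤ 2 * p - 1 →
      ∑ j ∈ Finset.Icc 1 p, A i j * F.eval (g i j)
        = ∫ t in (x (i - 1))..(x i), F.eval t / betaPW βm βp α t) →
    (∀ i ∈ Finset.Icc 1 N, ∀ j ∈ Finset.Icc 1 p, κ * (x i - x (i - 1)) ≤ A i j) →
    (∀ i ∈ Finset.Icc 1 N, x i - x (i - 1) ≤ hm) →
    hm ≤ h₀ →
    ∀ v : ℝ → ℝ, MemUT p N k a b α βm βp x v → (¬ ∀ t ∈ Set.Icc a b, v t = 0) →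
    ∃ w : ℕ → ℕ → ℝ, w N p = 0 ∧ 0 < normTp N p x w ∧
      c₀ * gnorm N p a b βm βp α g A v * normTp N p x w ≤ aform N p γ c βm βp α g v w) := by
  set b₀ := min βm βp with hb₀
  have hb : 0 < b₀ := lt_min hβm hβp
  set K₁ : ℝ := 1 / b₀ + p * d * (4 * d / b₀) with hK₁
  set K₂ : ℝ := 1 + (1 + d ^ 2) / b₀ with hK₂
  set K₃ : ℝ := (2 * γ ^ 2 + 2 * c ^ 2 * d ^ 2 + 4) / b₀ with hK₃
  have hK₁0 : 0 < K₁ := by positivity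
  have hK₂0 : 0 < K₂ := by positivity
  have hK₃0 : 0 < K₃ := by positivity
  refine ⟨1 / K₃, 1 / (2 * (√K₂ * √K₁)), by positivity, by positivity, ?_⟩
  intro N k a b α hm x g A hab hN hk hkN _ ha hbN hx hα₁ hα₂ hg _ hgs hA hquad hκA hmesh hh₀
    v hv hv0
  have H := hv.fluxQuadrature hp hβm hβp hN hk hkN ha hbN hx hα₁ hα₂ hg hgs hA hquad
  subst ha hbN
  set r : ℕ → ℕ → ℝ := fun i j => betaPW βm βp α (g i j) * deriv v (g i j) with hr
  set E := fluxEnergy N p A r with hE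
  have hE0 : 0 < E := H.energy_pos hv0
  have hlower := H.mul_energy_le_normTpSq hκA
  have hupper := H.normTpSq_fluxTest_le
  have hform := H.energy_mul_le_form γ hc.le fun i hi => (hmesh i hi).trans hh₀
  have hH1 := H.integral_sq_add_sq_le
  rw [hab] at hupper hform hH1
  refine ⟨fluxTest x A r v, ?_, Real.sqrt_pos.2 ((mul_pos hκ hE0).trans_le hlower), ?_⟩
  · rw [H.fluxTest_last (Finset.mem_Icc.2 ⟨hN, le_rfl⟩), H.right_eq_zero]
  have hG : gnorm N p (x 0) (x N) βm βp α g A v ≤ √K₂ * √E := by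
    rw [gnorm, ← Real.sqrt_mul hK₂0.le, hK₂, add_mul, one_mul]
    exact Real.sqrt_le_sqrt (add_le_add le_rfl hH1)
  have hT : normTp N p x (fluxTest x A r v) ≤ √K₁ * √E := by
    rw [normTp, ← Real.sqrt_mul hK₁0.le]
    exact Real.sqrt_le_sqrt hupper
  have hhalf : E * (1 - 1 / K₃ / 2 * K₃) = E / 2 := by
    field_simp
    ring
  rw [hhalf] at hform
  calc 1 / (2 * (√K₂ * √K₁)) * gnorm N p (x 0) (x N) βm βp α g A v
        * normTp N p x (fluxTest x A r v)
      ≤ 1 / (2 * (√K₂ * √K₁)) * (√K₂ * √E) * (√K₁ * √E) := by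
        gcongr
        exact Real.sqrt_nonneg _
    _ = √E * √E / 2 := by field_simp
    _ = E / 2 := by rw [Real.mul_self_sqrt hE0.le]
    _ ≤ _ := hform
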